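/- Let λ > 0, μ ∈ ℝ, n ∈ ℕ, and let h̃_{λ,n}(u) = λ^{1/4} h_n(λ^{1/2} u). Then for all (x,y) ∈ ℝ³ × ℝ³, the diagonal matrix coefficient of the representation π_{λ,μ} satisfies ⟨π_{λ,μ}(x,y) h̃_{λ,n}, h̃_{λ,n}⟩_{L²(ℝ)} = (1/(2πλ)) e^{iλ y₃} e^{iμ x₃} ∫_{ℝ²} e^{i(v₁ x₁ + v₂ x₂)} ℒ_n^{(0)}((v₁² + v₂²)/λ) dv₁ dv₂. -/

import Mathlib

/-- The `n`-th Hermite function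
`h_n(t) = (-1)^n (n! 2^n √π)^{-1/2} e^{t²/2} (d/dt)^n e^{-t²}`. -/
noncomputable def hermiteF (n : ℕ) (t : ℝ) : ℝ :=
  (-1 : ℝ) ^ n * (Real.sqrt (n.factorial * 2 ^ n * Real.sqrt Real.pi))⁻¹ *
    Real.exp (t ^ 2 / 2) * iteratedDeriv n (fun s : ℝ => Real.exp (-s ^ 2)) t

/-- The rescaled Hermite function `h̃_{λ,n}(u) = λ^{1/4} h_n(λ^{1/2} u)`. -/
noncomputable def hermiteTilde (lam : ℝ) (n : ℕ) (u : ℝ) : ℝ :=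
  lam ^ ((1 : ℝ) / 4) * hermiteF n (lam ^ ((1 : ℝ) / 2) * u)

/-- The generalized Laguerre polynomial of type `k`:
`L_n^{(k)}(u) = (u^{-k} e^u / n!) (d/du)^n (u^{k+n} e^{-u})`. -/
noncomputable def lagP (n k : ℕ) (u : ℝ) : ℝ :=
  Real.exp u / (n.factorial * u ^ k) *
    iteratedDeriv n (fun v : ℝ => v ^ (k + n) * Real.exp (-v)) u

/-- The Laguerre function `ℒ_n^{(k)}(t) = 2 (-1)^n e^{-t} L_n^{(k)}(2t)`. -/
noncomputable def lagF (n k : ℕ) (t : ℝ) : ℝ :=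
  2 * (-1 : ℝ) ^ n * Real.exp (-t) * lagP n k (2 * t)

open MeasureTheory Polynomial

section Recurrence

/-- The solution of a two-index ladder recurrence whose weights are `c * k`. -/
theorem ladder_eq_sum {a b c : ℂ} {N : ℕ → ℕ → ℂ} (h0 : ∀ k, N 0 k = b ^ k * N 0 0)
    (hs : ∀ j k, N (j + 1) k = a * N j k + c * k * N j (k - 1)) (j : ℕ) :
    ∀ (m k : ℕ), j ≤ m → N j k = (∑ i ∈ Finset.range (m + 1), (j.choose i : ℂ) * a ^ (j - i) *
      ((k.choose i : ℂ) * i.factorial * c ^ i * b ^ (k - i))) * N 0 0 := by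
  induction j with
  | zero =>
    intro m k _
    rw [Finset.sum_range_succ', h0]
    simp
  | succ j ih =>
    intro m k hm
    obtain ⟨m, rfl⟩ : ∃ m', m = m' + 1 := ⟨m - 1, by omega⟩
    have hg (i : ℕ) : (k.choose (i + 1) : ℂ) * (i + 1).factorial * c ^ (i + 1) * b ^ (k - (i + 1))
        = c * k * (((k - 1).choose i : ℂ) * i.factorial * c ^ i * b ^ (k - 1 - i)) := by
      rcases k with _ | k
      · simp
      · have h := Nat.add_one_mul_choose_eq k i
        have h' : ((k + 1 : ℕ) : ℂ) * (k.choose i : ℂ)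
            = ((k + 1).choose (i + 1) : ℂ) * ((i + 1 : ℕ) : ℂ) := by exact_mod_cast h
        rw [Nat.factorial_succ, Nat.add_sub_cancel, Nat.add_sub_add_right]
        push_cast at h' ⊢
        linear_combination (-c ^ (i + 1) * i.factorial * b ^ (k - i)) * h'
    have hf (i : ℕ) : ((j + 1).choose (i + 1) : ℂ) * a ^ (j + 1 - (i + 1))
        = (j.choose i : ℂ) * a ^ (j - i) + a * ((j.choose (i + 1) : ℂ) * a ^ (j - (i + 1))) := by
      rw [Nat.choose_succ_succ, Nat.add_sub_add_right]
      rcases Nat.lt_or_ge i j with hij | hij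
      · rw [show j - i = j - (i + 1) + 1 by omega]
        push_cast
        ring
      · rw [Nat.choose_eq_zero_of_lt (show j < i + 1 by omega)]
        simp
    rw [hs, ih (m + 1) k (by omega), ih m (k - 1) (by omega),
      Finset.sum_range_succ' _ (m + 1), Finset.sum_range_succ' _ (m + 1)]
    have hsum : ∑ i ∈ Finset.range (m + 1), ((j + 1).choose (i + 1) : ℂ) * a ^ (j + 1 - (i + 1)) *
          ((k.choose (i + 1) : ℂ) * (i + 1).factorial * c ^ (i + 1) * b ^ (k - (i + 1)))
        = a * ∑ i ∈ Finset.range (m + 1), (j.choose (i + 1) : ℂ) * a ^ (j - (i + 1)) *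
          ((k.choose (i + 1) : ℂ) * (i + 1).factorial * c ^ (i + 1) * b ^ (k - (i + 1)))
        + c * k * ∑ i ∈ Finset.range (m + 1), (j.choose i : ℂ) * a ^ (j - i) *
          (((k - 1).choose i : ℂ) * i.factorial * c ^ i * b ^ (k - 1 - i)) := by
      rw [Finset.mul_sum, Finset.mul_sum, ← Finset.sum_add_distrib]
      refine Finset.sum_congr rfl fun i _ => ?_
      rw [hf]
      linear_combination ((j.choose i : ℂ) * a ^ (j - i)) * hg i
    rw [hsum]
    simp only [Nat.choose_zero_right, Nat.sub_zero, pow_succ]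
    ring

/-- The Laguerre polynomial `L_n`, as an explicit sum. -/
noncomputable def laguerreSum (n : ℕ) (u : ℂ) : ℂ :=
  ∑ i ∈ Finset.range (n + 1), (n.choose i : ℂ) * (-u) ^ i / i.factorial

theorem factorial_mul_laguerreSum (n : ℕ) (u : ℂ) :
    n.factorial * laguerreSum n u = ∑ i ∈ Finset.range (n + 1),
      (n.choose i : ℂ) ^ 2 * i.factorial * (-u) ^ (n - i) := by
  rw [laguerreSum, ← Finset.sum_range_reflect, Finset.mul_sum]
  refine Finset.sum_congr rfl fun i hi => ?_
  have hi : i ≤ n := by simpa [Nat.lt_succ_iff] using hi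
  rw [show n + 1 - 1 - i = n - i by omega, Nat.choose_symm hi,
    ← Nat.choose_mul_factorial_mul_factorial hi]
  have := Nat.cast_ne_zero (R := ℂ).2 (n - i).factorial_ne_zero
  push_cast
  field_simp

theorem ladder_diagonal {a b c : ℂ} (hc : c ≠ 0) {N : ℕ → ℕ → ℂ} (h0 : ∀ k, N 0 k = b ^ k * N 0 0)
    (hs : ∀ j k, N (j + 1) k = a * N j k + c * k * N j (k - 1)) (n : ℕ) :
    N n n = c ^ n * n.factorial * laguerreSum n (-(a * b / c)) * N 0 0 := by
  rw [mul_assoc (c ^ n), factorial_mul_laguerreSum, ladder_eq_sum h0 hs n n n le_rfl,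
    Finset.mul_sum]
  congr 1
  refine Finset.sum_congr rfl fun i hi => ?_
  have hi : i ≤ n := by simpa [Nat.lt_succ_iff] using hi
  rw [neg_neg, div_pow, mul_pow, show c ^ n = c ^ i * c ^ (n - i) by rw [← pow_add]; congr; omega]
  field_simp

/-- The multiplication formula for the argument `2 * u` of a Laguerre polynomial. -/
theorem sum_choose_mul_laguerreSum (n : ℕ) (u : ℂ) :
    ∑ k ∈ Finset.range (n + 1), (n.choose k : ℂ) * (-2) ^ k * laguerreSum k u
      = (-1) ^ n * laguerreSum n (2 * u) := by
  have hk : ∀ k ∈ Finset.range (n + 1), (n.choose k : ℂ) * (-2) ^ k * laguerreSum k u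
      = ∑ j ∈ Finset.range (n + 1),
        (n.choose k : ℂ) * (k.choose j : ℂ) * (-2) ^ k * ((-u) ^ j / j.factorial) := by
    intro k hk
    have hk : k + 1 ≤ n + 1 := by simpa using hk
    rw [laguerreSum, Finset.mul_sum]
    refine Finset.sum_subset_zero_on_sdiff (Finset.range_mono hk) (fun j hj => ?_)
      fun j _ => by ring
    rw [Nat.choose_eq_zero_of_lt (n := k) (k := j) (by simp at hj; omega)]
    simp
  rw [Finset.sum_congr rfl hk, Finset.sum_comm, laguerreSum, Finset.mul_sum]
  refine Finset.sum_congr rfl fun j hj => ?_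
  have hj : j ≤ n := by simpa [Nat.lt_succ_iff] using hj
  rw [← Finset.sum_mul]
  have key : ∑ k ∈ Finset.range (n + 1), (n.choose k : ℂ) * (k.choose j : ℂ) * (-2) ^ k
      = n.choose j * (-2) ^ j * (-1) ^ (n - j) := by
    rw [show n + 1 = j + (n - j + 1) by omega, Finset.sum_range_add,
      Finset.sum_eq_zero, zero_add, show (-1 : ℂ) = -2 + 1 by norm_num, add_pow, Finset.mul_sum]
    · refine Finset.sum_congr rfl fun i hi => ?_
      have h := Nat.choose_mul (n := n) (k := j + i) (s := j) (by omega)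
      rw [Nat.add_sub_cancel_left] at h
      have h' : (n.choose (j + i) : ℂ) * ((j + i).choose j : ℂ)
        = (n.choose j : ℂ) * ((n - j).choose i : ℂ) := by exact_mod_cast h
      rw [h', pow_add]
      ring
    · intro k hk
      rw [Nat.choose_eq_zero_of_lt (n := k) (k := j) (by simpa using hk)]
      simp
  rw [key]
  have h1 : (-1 : ℂ) ^ n = (-1) ^ (n - j) * (-1) ^ j := by rw [← pow_add]; congr; omega
  rw [h1, neg_mul_eq_mul_neg 2 u, mul_pow 2 (-u), show (-2 : ℂ) = (-1) * 2 by norm_num, mul_pow]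
  ring

end Recurrence

section Special

theorem ofReal_lagF (n : ℕ) (t : ℝ) :
    (lagF n 0 t : ℂ) = 2 * (-1) ^ n * Complex.exp (-t) * laguerreSum n (2 * t) := by
  have hlag : (lagP n 0 (2 * t) : ℂ) = laguerreSum n (2 * t) := by
    have hn : (n.factorial : ℂ) ≠ 0 := Nat.cast_ne_zero.2 n.factorial_ne_zero
    rw [← mul_right_inj' hn, factorial_mul_laguerreSum, lagP, zero_add,
      iteratedDeriv_fun_mul (by fun_prop) (by fun_prop)]
    have he (k : ℕ) : iteratedDeriv k (fun v : ℝ => Real.exp (-v)) (2 * t)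
        = (-1) ^ k * Real.exp (-(2 * t)) := by
      have := congrFun (iteratedDeriv_exp_const_mul k (-1)) (2 * t)
      simpa only [neg_one_mul] using this
    simp only [he, iteratedDeriv_pow, pow_zero, mul_one, Nat.descFactorial_eq_factorial_mul_choose]
    push_cast
    rw [Finset.mul_sum, Finset.mul_sum]
    refine Finset.sum_congr rfl fun i _ => ?_
    rw [Complex.exp_neg]
    field_simp
    rw [neg_pow (2 * (t : ℂ))]
    ring
  rw [lagF]
  push_cast
  rw [hlag]

/-- The Hermite polynomials, in the normalization with leading coefficient `2 ^ n`. -/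
noncomputable def physHermite : ℕ → ℝ[X]
  | 0 => 1
  | n + 1 => 2 * X * physHermite n - derivative (physHermite n)

theorem physHermite_succ (n : ℕ) :
    physHermite (n + 1) = 2 * X * physHermite n - derivative (physHermite n) := rfl

theorem derivative_physHermite (n : ℕ) :
    derivative (physHermite n) = 2 * (n : ℝ[X]) * physHermite (n - 1) := by
  induction n with
  | zero => simp [physHermite]
  | succ n ih =>
    rw [physHermite_succ, Nat.add_sub_cancel, derivative_sub, ih]
    rcases n with _ | n
    · simp [physHermite]
    · have h := physHermite_succ n
      rw [Nat.add_sub_cancel] at *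
      simp only [derivative_mul, derivative_X, derivative_ofNat, derivative_natCast]
      rw [ih]
      push_cast
      linear_combination (-2 * ((n : ℝ[X]) + 1)) * h

theorem iteratedDeriv_exp_neg_sq (n : ℕ) :
    iteratedDeriv n (fun s : ℝ => Real.exp (-s ^ 2))
      = fun s => (-1) ^ n * (physHermite n).eval s * Real.exp (-s ^ 2) := by
  induction n with
  | zero => simp [physHermite]
  | succ n ih =>
    funext s
    rw [iteratedDeriv_succ, ih]
    have h1 : HasDerivAt (fun s : ℝ => Real.exp (-s ^ 2)) (Real.exp (-s ^ 2) * (-(2 * s))) s := by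
      simpa using ((hasDerivAt_pow 2 s).neg).exp
    have h := (((physHermite n).hasDerivAt s).const_mul ((-1) ^ n)).mul h1
    refine h.deriv.trans ?_
    rw [physHermite_succ]
    simp only [eval_sub, eval_mul, eval_X, eval_ofNat]
    ring

theorem hermiteF_eq (n : ℕ) (t : ℝ) :
    hermiteF n t = (Real.sqrt (n.factorial * 2 ^ n * Real.sqrt Real.pi))⁻¹ *
      (physHermite n).eval t * Real.exp (-(t ^ 2 / 2)) := by
  rw [hermiteF, iteratedDeriv_exp_neg_sq]
  have h1 : (-1 : ℝ) ^ n * (-1) ^ n = 1 := by rw [← mul_pow]; simp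
  have h2 : Real.exp (t ^ 2 / 2) * Real.exp (-t ^ 2) = Real.exp (-(t ^ 2 / 2)) := by
    rw [← Real.exp_add]; ring_nf
  linear_combination (Real.sqrt (n.factorial * 2 ^ n * Real.sqrt Real.pi))⁻¹ *
      (physHermite n).eval t * (Real.exp (t ^ 2 / 2) * Real.exp (-t ^ 2) * h1 + h2)

end Special

section Gaussian

/-- The modulated Gaussian `e^{iqt - t²}`. -/
noncomputable def gaussWave (q t : ℝ) : ℂ :=
  Complex.exp (Complex.I * q * t - t ^ 2)

theorem hasDerivAt_gaussWave (q t : ℝ) :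
    HasDerivAt (gaussWave q) (gaussWave q t * (Complex.I * q - 2 * t)) t := by
  have h : HasDerivAt (fun z : ℂ => Complex.exp (Complex.I * q * z - z ^ 2))
      (Complex.exp (Complex.I * q * t - t ^ 2) * (Complex.I * q - 2 * t)) (t : ℂ) := by
    have := (((hasDerivAt_id (t : ℂ)).const_mul (Complex.I * q)).sub
      (hasDerivAt_pow 2 (t : ℂ))).cexp
    simpa using this
  exact h.comp_ofReal

theorem integrable_pow_mul_gaussWave (q : ℝ) (n : ℕ) :
    Integrable fun t : ℝ => (t : ℂ) ^ n * gaussWave q t := by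
  have h := integrable_rpow_mul_exp_neg_mul_sq one_pos (s := n)
    (by linarith [(Nat.cast_nonneg n : (0 : ℝ) ≤ n)])
  refine h.mono (Continuous.aestronglyMeasurable (by unfold gaussWave; fun_prop))
    (Filter.Eventually.of_forall fun t => le_of_eq ?_)
  simp [gaussWave, Complex.norm_exp, ← Complex.ofReal_pow]

theorem integral_gaussWave (q : ℝ) :
    ∫ t : ℝ, gaussWave q t = (Real.sqrt Real.pi : ℂ) * Complex.exp (-q ^ 2 / 4) := by
  have h := fourierIntegral_gaussian (b := 1) (by simp) q
  rw [mul_one, div_one] at h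
  rw [Real.sqrt_eq_rpow, Complex.ofReal_cpow Real.pi_pos.le]
  push_cast
  rw [← h]
  refine integral_congr_ae (Filter.Eventually.of_forall fun t => ?_)
  simp only [gaussWave, ← Complex.exp_add]
  ring_nf

theorem integrable_eval_mul_gaussWave (q : ℝ) (P : ℝ[X]) :
    Integrable fun t : ℝ => ((P.eval t : ℝ) : ℂ) * gaussWave q t := by
  induction P using Polynomial.induction_on' with
  | add P Q hP hQ =>
    simp only [eval_add, Complex.ofReal_add, add_mul]
    exact hP.add hQ
  | monomial n a =>
    simpa [mul_assoc] using (integrable_pow_mul_gaussWave q n).const_mul (a : ℂ)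

/-- The Fourier integral of a polynomial times the Gaussian. -/
noncomputable def gaussFourier (q : ℝ) : ℝ[X] →ₗ[ℝ] ℂ where
  toFun P := ∫ t : ℝ, ((P.eval t : ℝ) : ℂ) * gaussWave q t
  map_add' P Q := by
    simp only [eval_add, Complex.ofReal_add, add_mul]
    exact integral_add (integrable_eval_mul_gaussWave q P) (integrable_eval_mul_gaussWave q Q)
  map_smul' a P := by
    simp only [eval_smul, smul_eq_mul, Complex.ofReal_mul, mul_assoc, Complex.real_smul,
      RingHom.id_apply]
    exact integral_const_mul _ _

theorem gaussFourier_apply (q : ℝ) (P : ℝ[X]) :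
    gaussFourier q P = ∫ t : ℝ, ((P.eval t : ℝ) : ℂ) * gaussWave q t := rfl

theorem gaussFourier_two_mul_X_mul (q : ℝ) (P : ℝ[X]) :
    gaussFourier q (2 * X * P)
      = gaussFourier q (derivative P) + Complex.I * q * gaussFourier q P := by
  have h1 := integrable_eval_mul_gaussWave q P
  have h2 := integrable_eval_mul_gaussWave q (derivative P)
  have h3 := integrable_eval_mul_gaussWave q (2 * X * P)
  have hd (t : ℝ) : HasDerivAt (fun t : ℝ => ((P.eval t : ℝ) : ℂ) * gaussWave q t)
      ((((derivative P).eval t : ℝ) : ℂ) * gaussWave q t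
        + Complex.I * q * (((P.eval t : ℝ) : ℂ) * gaussWave q t)
        - (((2 * X * P).eval t : ℝ) : ℂ) * gaussWave q t) t := by
    refine ((P.hasDerivAt t).ofReal_comp.mul (hasDerivAt_gaussWave q t)).congr_deriv ?_
    simp only [eval_mul, eval_X, eval_ofNat]
    push_cast
    ring
  have h := integral_eq_zero_of_hasDerivAt_of_integrable hd ((h2.add (h1.const_mul _)).sub h3) h1
  rw [integral_sub (by exact h2.add (h1.const_mul _)) h3, integral_add h2 (h1.const_mul _),
    integral_const_mul] at h
  exact (sub_eq_zero.1 h).symm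

/-- The Fourier integral of a product of two Hermite polynomials shifted apart by `p`. -/
theorem gaussFourier_physHermite (p q : ℝ) (n : ℕ) :
    gaussFourier q ((physHermite n).comp (X + C (p / 2)) * (physHermite n).comp (X - C (p / 2)))
      = 2 ^ n * n.factorial * laguerreSum n ((p ^ 2 + q ^ 2) / 2) *
        ((Real.sqrt Real.pi : ℂ) * Complex.exp (-q ^ 2 / 4)) := by
  set A : ℕ → ℝ[X] := fun n => (physHermite n).comp (X + C (p / 2)) with hA
  set B : ℕ → ℝ[X] := fun n => (physHermite n).comp (X - C (p / 2)) with hB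
  have hA' (j : ℕ) : A (j + 1) = 2 * X * A j + p • A j - derivative (A j) := by
    simp only [hA, physHermite_succ, sub_comp, mul_comp, X_comp, ofNat_comp, derivative_comp,
      derivative_add, derivative_X, derivative_C, smul_eq_C_mul]
    have : (C p : ℝ[X]) = 2 * C (p / 2) := by
      rw [show (2 : ℝ[X]) = C 2 from rfl, ← C_mul]; congr 1; ring
    rw [this]
    ring
  have hB' (j : ℕ) : B (j + 1) = 2 * X * B j - p • B j - derivative (B j) := by
    simp only [hB, physHermite_succ, sub_comp, mul_comp, X_comp, ofNat_comp, derivative_comp,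
      derivative_sub, derivative_X, derivative_C, smul_eq_C_mul]
    have : (C p : ℝ[X]) = 2 * C (p / 2) := by
      rw [show (2 : ℝ[X]) = C 2 from rfl, ← C_mul]; congr 1; ring
    rw [this]
    ring
  have hdB (k : ℕ) : derivative (B k) = (2 * k : ℝ) • B (k - 1) := by
    simp only [hB, derivative_comp, derivative_physHermite, derivative_sub, derivative_X,
      derivative_C, mul_comp, ofNat_comp, natCast_comp, smul_eq_C_mul, C_mul, C_ofNat, map_natCast]
    ring
  have hA0 : A 0 = 1 := by simp [hA, physHermite]
  have hB0 : B 0 = 1 := by simp [hB, physHermite]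
  have h0 (k : ℕ) : gaussFourier q (A 0 * B k) =
      (Complex.I * q - p) ^ k * gaussFourier q (A 0 * B 0) := by
    rw [hA0, hB0]
    induction k with
    | zero => simp [hB0]
    | succ k ih =>
      rw [hB', one_mul, map_sub, map_sub, gaussFourier_two_mul_X_mul, map_smul, pow_succ',
        mul_assoc (Complex.I * q - p), ← ih, one_mul, Complex.real_smul]
      ring
  have hs (j k : ℕ) : gaussFourier q (A (j + 1) * B k) =
      (Complex.I * q + p) * gaussFourier q (A j * B k)
        + 2 * k * gaussFourier q (A j * B (k - 1)) := by
    have : A (j + 1) * B k = 2 * X * (A j * B k) + p • (A j * B k)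
        - derivative (A j * B k) + (2 * k : ℝ) • (A j * B (k - 1)) := by
      rw [hA', derivative_mul, hdB]
      simp only [smul_eq_C_mul]
      ring
    rw [this, map_add, map_sub, map_add, gaussFourier_two_mul_X_mul, map_smul, map_smul,
      Complex.real_smul, Complex.real_smul]
    push_cast
    ring
  have h := ladder_diagonal (N := fun j k => gaussFourier q (A j * B k)) two_ne_zero h0 hs n
  rw [h, hA0, hB0, mul_one, gaussFourier_apply]
  simp only [eval_one, Complex.ofReal_one, one_mul]
  rw [integral_gaussWave]
  congr 3
  linear_combination (-(q : ℂ) ^ 2 / 2) * Complex.I_sq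

/-- The function `z^j z̄^k e^{i(p v₁ + q v₂) - |v|²}` of `v` in the plane, where `z = v₁ + i v₂`. -/
noncomputable def planeMoment (p q : ℝ) (j k : ℕ) (v : ℝ × ℝ) : ℂ :=
  (v.1 + Complex.I * v.2) ^ j * (v.1 - Complex.I * v.2) ^ k * (gaussWave p v.1 * gaussWave q v.2)

theorem integrable_planeMoment (p q : ℝ) (j k : ℕ) : Integrable (planeMoment p q j k) := by
  suffices h : ∀ j k a b : ℕ, Integrable fun v : ℝ × ℝ =>
      (v.1 : ℂ) ^ a * (v.2 : ℂ) ^ b * planeMoment p q j k v by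
    simpa only [pow_zero, one_mul] using h j k 0 0
  intro j
  induction j with
  | zero =>
    intro k
    induction k with
    | zero =>
      intro a b
      have := (integrable_pow_mul_gaussWave p a).mul_prod (integrable_pow_mul_gaussWave q b)
      refine this.congr (Filter.Eventually.of_forall fun v => ?_)
      simp only [planeMoment]
      ring
    | succ k ih =>
      intro a b
      refine ((ih (a + 1) b).sub ((ih a (b + 1)).const_mul Complex.I)).congr
        (Filter.Eventually.of_forall fun v => ?_)
      simp only [planeMoment, Pi.sub_apply]
      ring
  | succ j ih =>
    intro k a b
    refine ((ih k (a + 1) b).add ((ih k a (b + 1)).const_mul Complex.I)).congr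
      (Filter.Eventually.of_forall fun v => ?_)
    simp only [planeMoment, Pi.add_apply]
    ring

theorem integral_eq_zero_of_hasDerivAt_fst {f f' : ℝ × ℝ → ℂ} (hf : Integrable f)
    (hf' : Integrable f') (h : ∀ x y, HasDerivAt (fun x => f (x, y)) (f' (x, y)) x) :
    ∫ v, f' v = 0 := by
  rw [Measure.volume_eq_prod] at *
  rw [integral_prod_symm _ hf']
  refine integral_eq_zero_of_ae ?_
  filter_upwards [hf.prod_left_ae, hf'.prod_left_ae] with y h1 h2
  exact integral_eq_zero_of_hasDerivAt_of_integrable (fun x => h x y) h2 h1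

theorem integral_eq_zero_of_hasDerivAt_snd {f f' : ℝ × ℝ → ℂ} (hf : Integrable f)
    (hf' : Integrable f') (h : ∀ x y, HasDerivAt (fun y => f (x, y)) (f' (x, y)) y) :
    ∫ v, f' v = 0 := by
  rw [Measure.volume_eq_prod] at *
  rw [integral_prod _ hf']
  refine integral_eq_zero_of_ae ?_
  filter_upwards [hf.prod_right_ae, hf'.prod_right_ae] with x h1 h2
  exact integral_eq_zero_of_hasDerivAt_of_integrable (fun y => h x y) h2 h1

theorem hasDerivAt_planeMoment_fst (p q : ℝ) (j k : ℕ) (x y : ℝ) :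
    HasDerivAt (fun x => planeMoment p q j k (x, y))
      (j * planeMoment p q (j - 1) k (x, y) + k * planeMoment p q j (k - 1) (x, y)
        + Complex.I * p * planeMoment p q j k (x, y) - planeMoment p q (j + 1) k (x, y)
        - planeMoment p q j (k + 1) (x, y)) x := by
  have hx : HasDerivAt (fun x : ℝ => (x : ℂ)) 1 x := (hasDerivAt_id (x : ℂ)).comp_ofReal
  refine ((((hx.add_const (Complex.I * y)).pow j).mul ((hx.sub_const (Complex.I * y)).pow k)).mul
    ((hasDerivAt_gaussWave p x).mul_const (gaussWave q y))).congr_deriv ?_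
  simp only [planeMoment, Pi.mul_apply, Pi.pow_apply]
  ring

theorem hasDerivAt_planeMoment_snd (p q : ℝ) (j k : ℕ) (x y : ℝ) :
    HasDerivAt (fun y => planeMoment p q j k (x, y))
      (Complex.I * j * planeMoment p q (j - 1) k (x, y)
        + -Complex.I * k * planeMoment p q j (k - 1) (x, y)
        + Complex.I * q * planeMoment p q j k (x, y)
        - -Complex.I * planeMoment p q (j + 1) k (x, y)
        - Complex.I * planeMoment p q j (k + 1) (x, y)) y := by
  have hy : HasDerivAt (fun y : ℝ => Complex.I * (y : ℂ)) Complex.I y := by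
    simpa using ((hasDerivAt_id (y : ℂ)).const_mul Complex.I).comp_ofReal
  refine ((((hy.const_add (x : ℂ)).pow j).mul ((hy.const_sub (x : ℂ)).pow k)).mul
    ((hasDerivAt_gaussWave q y).const_mul (gaussWave p x))).congr_deriv ?_
  simp only [planeMoment, Pi.mul_apply, Pi.pow_apply]
  linear_combination (-2 * (y : ℂ) * (x + Complex.I * y) ^ j * (x - Complex.I * y) ^ k *
    (gaussWave p x * gaussWave q y)) * Complex.I_sq

/-- Combined integration by parts in both variables, along `∂₁ + i ∂₂` and `∂₁ - i ∂₂`. -/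
theorem integral_planeMoment_succ (p q : ℝ) (j k : ℕ) :
    2 * k * (∫ v, planeMoment p q j (k - 1) v) + (Complex.I * p - q) * (∫ v, planeMoment p q j k v)
        = 2 * ∫ v, planeMoment p q (j + 1) k v ∧
      2 * j * (∫ v, planeMoment p q (j - 1) k v)
        + (Complex.I * p + q) * (∫ v, planeMoment p q j k v)
      = 2 * ∫ v, planeMoment p q j (k + 1) v := by
  have hi := integrable_planeMoment p q
  have hcomb (a b c d e : ℂ) : Integrable (fun v => a * planeMoment p q (j - 1) k v
        + b * planeMoment p q j (k - 1) v + c * planeMoment p q j k v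
        - d * planeMoment p q (j + 1) k v - e * planeMoment p q j (k + 1) v) ∧
      ∫ v, (a * planeMoment p q (j - 1) k v
        + b * planeMoment p q j (k - 1) v + c * planeMoment p q j k v
        - d * planeMoment p q (j + 1) k v - e * planeMoment p q j (k + 1) v) =
      a * (∫ v, planeMoment p q (j - 1) k v)
        + b * (∫ v, planeMoment p q j (k - 1) v) + c * (∫ v, planeMoment p q j k v)
        - d * (∫ v, planeMoment p q (j + 1) k v) - e * ∫ v, planeMoment p q j (k + 1) v := by
    have h1 := (hi (j - 1) k).const_mul a
    have h2 := (hi j (k - 1)).const_mul b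
    have h3 := (hi j k).const_mul c
    have h4 := (hi (j + 1) k).const_mul d
    have h5 := (hi j (k + 1)).const_mul e
    refine ⟨(((h1.add h2).add h3).sub h4).sub h5, ?_⟩
    rw [integral_sub (by exact ((h1.add h2).add h3).sub h4) h5,
      integral_sub (by exact (h1.add h2).add h3) h4, integral_add (by exact h1.add h2) h3,
      integral_add h1 h2]
    simp only [integral_const_mul]
  obtain ⟨i1, e1⟩ := hcomb j k (Complex.I * p) 1 1
  obtain ⟨i2, e2⟩ := hcomb (Complex.I * j) (-Complex.I * k) (Complex.I * q) (-Complex.I) Complex.I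
  have z1 := integral_eq_zero_of_hasDerivAt_fst (hi j k) i1 fun x y => by
    simpa only [one_mul] using hasDerivAt_planeMoment_fst p q j k x y
  have z2 := integral_eq_zero_of_hasDerivAt_snd (hi j k) i2 (hasDerivAt_planeMoment_snd p q j k)
  rw [e1] at z1
  rw [e2] at z2
  have hI := Complex.I_sq
  constructor
  · linear_combination z1 + Complex.I * z2 - (j * (∫ v, planeMoment p q (j - 1) k v)
      - k * (∫ v, planeMoment p q j (k - 1) v) + q * (∫ v, planeMoment p q j k v)
      + (∫ v, planeMoment p q (j + 1) k v) - ∫ v, planeMoment p q j (k + 1) v) * hI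
  · linear_combination z1 - Complex.I * z2 + (j * (∫ v, planeMoment p q (j - 1) k v)
      - k * (∫ v, planeMoment p q j (k - 1) v) + q * (∫ v, planeMoment p q j k v)
      + (∫ v, planeMoment p q (j + 1) k v) - ∫ v, planeMoment p q j (k + 1) v) * hI

theorem integral_planeMoment_zero (p q : ℝ) :
    ∫ v, planeMoment p q 0 0 v = Real.pi * Complex.exp (-(p ^ 2 + q ^ 2) / 4) := by
  have h := integral_prod_mul (μ := volume) (ν := volume) (gaussWave p) (gaussWave q)
  rw [← Measure.volume_eq_prod, integral_gaussWave, integral_gaussWave] at h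
  simp only [planeMoment, pow_zero, one_mul]
  rw [h, mul_mul_mul_comm, ← Complex.exp_add, ← Complex.ofReal_mul,
    Real.mul_self_sqrt Real.pi_pos.le]
  ring_nf

theorem integral_planeMoment_diagonal (p q : ℝ) (k : ℕ) :
    ∫ v, planeMoment p q k k v = k.factorial * laguerreSum k ((p ^ 2 + q ^ 2) / 4) *
      (Real.pi * Complex.exp (-(p ^ 2 + q ^ 2) / 4)) := by
  have h := ladder_diagonal (a := (Complex.I * p - q) / 2) (b := (Complex.I * p + q) / 2)
    one_ne_zero (N := fun j k => ∫ v, planeMoment p q j k v) (fun k => ?_) (fun j k => ?_) k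
  · rw [h, integral_planeMoment_zero, one_pow, one_mul]
    congr 3
    linear_combination (-(p : ℂ) ^ 2 / 4) * Complex.I_sq
  · induction k with
    | zero => simp
    | succ k ih =>
      have := (integral_planeMoment_succ p q 0 k).2
      rw [Nat.cast_zero] at this
      rw [pow_succ']
      linear_combination (-1 / 2) * this + (Complex.I * p + q) / 2 * ih
  · linear_combination (-1 / 2) * (integral_planeMoment_succ p q j k).1

/-- The Fourier transform of the radial Laguerre function on the plane. -/
theorem integral_cexp_mul_lagF (n : ℕ) (p q : ℝ) :
    ∫ v : ℝ × ℝ, Complex.exp (Complex.I * (v.1 * p + v.2 * q)) * (lagF n 0 (v.1 ^ 2 + v.2 ^ 2) : ℂ)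
      = 2 * Real.pi * Complex.exp (-(p ^ 2 + q ^ 2) / 4) * laguerreSum n ((p ^ 2 + q ^ 2) / 2) := by
  have hv (v : ℝ × ℝ) : Complex.exp (Complex.I * (v.1 * p + v.2 * q)) *
      (lagF n 0 (v.1 ^ 2 + v.2 ^ 2) : ℂ) = ∑ k ∈ Finset.range (n + 1),
        2 * (-1) ^ n * ((n.choose k : ℂ) * (-2) ^ k / k.factorial) * planeMoment p q k k v := by
    have he : Complex.exp (Complex.I * (v.1 * p + v.2 * q)) * Complex.exp (-(v.1 ^ 2 + v.2 ^ 2))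
        = gaussWave p v.1 * gaussWave q v.2 := by
      simp only [gaussWave, ← Complex.exp_add]
      ring_nf
    have hz (k : ℕ) : planeMoment p q k k v
        = ((v.1 : ℂ) ^ 2 + v.2 ^ 2) ^ k * (gaussWave p v.1 * gaussWave q v.2) := by
      rw [planeMoment, ← mul_pow]
      congr 2
      linear_combination (-(v.2 : ℂ) ^ 2) * Complex.I_sq
    rw [ofReal_lagF]
    simp only [hz, ← he, laguerreSum]
    push_cast
    rw [Finset.mul_sum, Finset.mul_sum]
    refine Finset.sum_congr rfl fun k _ => ?_
    rw [← neg_mul, mul_pow]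
    ring
  simp only [hv]
  rw [integral_finsetSum _ fun k _ => (integrable_planeMoment p q k k).const_mul _]
  simp only [integral_const_mul, integral_planeMoment_diagonal]
  have h := sum_choose_mul_laguerreSum n (((p : ℂ) ^ 2 + q ^ 2) / 4)
  rw [show 2 * (((p : ℂ) ^ 2 + q ^ 2) / 4) = (p ^ 2 + q ^ 2) / 2 by ring] at h
  have h1 : (-1 : ℂ) ^ n * (-1) ^ n = 1 := by rw [← mul_pow]; simp
  have hsum : ∑ k ∈ Finset.range (n + 1), 2 * (-1) ^ n *
      ((n.choose k : ℂ) * (-2) ^ k / k.factorial) * (k.factorial *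
        laguerreSum k ((p ^ 2 + q ^ 2) / 4) * (Real.pi * Complex.exp (-(p ^ 2 + q ^ 2) / 4)))
      = 2 * (-1) ^ n * (Real.pi * Complex.exp (-(p ^ 2 + q ^ 2) / 4)) *
        ∑ k ∈ Finset.range (n + 1), (n.choose k : ℂ) * (-2) ^ k *
          laguerreSum k ((p ^ 2 + q ^ 2) / 4) := by
    rw [Finset.mul_sum]
    refine Finset.sum_congr rfl fun k _ => ?_
    have := Nat.cast_ne_zero (R := ℂ).2 k.factorial_ne_zero
    field_simp
  rw [hsum, h]
  linear_combination (2 * Real.pi * Complex.exp (-(p ^ 2 + q ^ 2) / 4) *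
    laguerreSum n ((p ^ 2 + q ^ 2) / 2)) * h1

/-- The Fourier-Wigner transform of the Hermite function `h_n`. -/
theorem integral_cexp_mul_hermiteF (n : ℕ) (p q : ℝ) :
    ∫ t : ℝ, Complex.exp (Complex.I * (t + p / 2) * q) *
        ((hermiteF n (p + t) * hermiteF n t : ℝ) : ℂ)
      = Complex.exp (-(p ^ 2 + q ^ 2) / 4) * laguerreSum n ((p ^ 2 + q ^ 2) / 2) := by
  set K : ℝ := (Real.sqrt (n.factorial * 2 ^ n * Real.sqrt Real.pi))⁻¹ with hK
  have hKK : K * K * (n.factorial * 2 ^ n * Real.sqrt Real.pi) = 1 := by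
    rw [hK, ← mul_inv, Real.mul_self_sqrt (by positivity)]
    exact inv_mul_cancel₀ (by positivity)
  set G : ℝ → ℂ := fun t => (K * K : ℝ) * Complex.exp (-p ^ 2 / 4) *
    ((((physHermite n).comp (X + C (p / 2)) * (physHermite n).comp (X - C (p / 2))).eval t : ℝ) *
      gaussWave q t) with hG
  have hshift (t : ℝ) : Complex.exp (Complex.I * (t + p / 2) * q) *
      ((hermiteF n (p + t) * hermiteF n t : ℝ) : ℂ) = G (t + p / 2) := by
    have he : Complex.exp (Complex.I * (t + p / 2) * q) * (Complex.exp (-((p + t) ^ 2 / 2)) *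
        Complex.exp (-(t ^ 2 / 2))) = Complex.exp (-p ^ 2 / 4) * gaussWave q (t + p / 2) := by
      simp only [gaussWave, ← Complex.exp_add]
      push_cast
      ring_nf
    simp only [hG, hermiteF_eq, eval_mul, eval_comp, eval_add, eval_sub, eval_X, eval_C]
    rw [show t + p / 2 + p / 2 = p + t by ring, show t + p / 2 - p / 2 = t by ring, ← hK]
    push_cast
    linear_combination ((K : ℂ) * K * ((physHermite n).eval (p + t) : ℝ) *
      ((physHermite n).eval t : ℝ)) * he
  simp only [hshift]
  rw [integral_add_right_eq_self G (p / 2), hG, integral_const_mul, ← gaussFourier_apply,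
    gaussFourier_physHermite]
  have hKK' : (K : ℂ) * K * (n.factorial * 2 ^ n * (Real.sqrt Real.pi : ℝ)) = 1 := by
    exact_mod_cast hKK
  rw [show -((p : ℂ) ^ 2 + q ^ 2) / 4 = -p ^ 2 / 4 + -q ^ 2 / 4 by ring, Complex.exp_add]
  push_cast
  linear_combination (Complex.exp (-p ^ 2 / 4) * Complex.exp (-q ^ 2 / 4) *
    laguerreSum n ((p ^ 2 + q ^ 2) / 2)) * hKK'

end Gaussian

/-- The diagonal matrix coefficient `⟨π_{λ,μ}(x,y) h̃_{λ,n}, h̃_{λ,n}⟩` of the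
Schrödinger-type representation `π_{λ,μ}` of `N_{3,2}`,
`(π_{λ,μ}(x,y)φ)(u) = e^{iλy₃} e^{iλ(u+x₁/2)x₂} e^{iμx₃} φ(x₁+u)`, equals
`(2πλ)^{-1} e^{iλy₃} e^{iμx₃} ∫_{ℝ²} e^{i(v₁x₁+v₂x₂)} ℒ_n^{(0)}((v₁²+v₂²)/λ) dv`. -/
theorem diagonal_matrix_coefficient (lam : ℝ) (hlam : 0 < lam) (mu : ℝ) (n : ℕ)
    (x y : Fin 3 → ℝ) :
    (∫ u : ℝ,
        (Complex.exp (Complex.I * lam * y 2)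
          * Complex.exp (Complex.I * lam * (u + x 0 / 2) * x 1)
          * Complex.exp (Complex.I * mu * x 2)
          * (hermiteTilde lam n (x 0 + u) : ℂ))
        * (starRingEnd ℂ) (hermiteTilde lam n u : ℂ))
      = (1 / (2 * Real.pi * lam) : ℝ)
        * Complex.exp (Complex.I * lam * y 2) * Complex.exp (Complex.I * mu * x 2)
        * ∫ v : ℝ × ℝ, Complex.exp (Complex.I * (v.1 * x 0 + v.2 * x 1))
            * (lagF n 0 ((v.1 ^ 2 + v.2 ^ 2) / lam) : ℂ) := by
  obtain ⟨s, hs, rfl⟩ : ∃ s : ℝ, 0 < s ∧ s ^ 2 = lam :=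
    ⟨Real.sqrt lam, Real.sqrt_pos.2 hlam, Real.sq_sqrt hlam.le⟩
  have hs0 : (s : ℂ) ≠ 0 := Complex.ofReal_ne_zero.2 hs.ne'
  have hpow : (s ^ 2) ^ ((1 : ℝ) / 2) = s := by
    rw [← Real.sqrt_eq_rpow, Real.sqrt_sq hs.le]
  have hpow' : (s ^ 2) ^ ((1 : ℝ) / 4) * (s ^ 2) ^ ((1 : ℝ) / 4) = s := by
    rw [← Real.rpow_add hlam]
    convert hpow using 2
    norm_num
  set G : ℝ → ℂ := fun t => Complex.exp (Complex.I * (t + (s * x 0 : ℝ) / 2) * (s * x 1 : ℝ)) *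
    ((hermiteF n (s * x 0 + t) * hermiteF n t : ℝ) : ℂ) with hG
  set E : ℂ := Complex.exp (Complex.I * (s ^ 2 : ℝ) * y 2) * Complex.exp (Complex.I * mu * x 2)
  have hleft (u : ℝ) : (Complex.exp (Complex.I * (s ^ 2 : ℝ) * y 2)
          * Complex.exp (Complex.I * (s ^ 2 : ℝ) * (u + x 0 / 2) * x 1)
          * Complex.exp (Complex.I * mu * x 2)
          * (hermiteTilde (s ^ 2) n (x 0 + u) : ℂ))
        * (starRingEnd ℂ) (hermiteTilde (s ^ 2) n u : ℂ) = E * s * G (s * u) := by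
    have he : Complex.exp (Complex.I * (s ^ 2 : ℝ) * (u + x 0 / 2) * x 1) =
        Complex.exp (Complex.I * ((s * u : ℝ) + (s * x 0 : ℝ) / 2) * (s * x 1 : ℝ)) := by
      push_cast
      ring_nf
    rw [Complex.conj_ofReal, he]
    simp only [hG, E, hermiteTilde, hpow, mul_add]
    have hc : (((s ^ 2) ^ ((1 : ℝ) / 4) : ℝ) : ℂ) * (((s ^ 2) ^ ((1 : ℝ) / 4) : ℝ) : ℂ) = s := by
      exact_mod_cast hpow'
    rw [← hc]
    simp only [Complex.ofReal_mul]
    ring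
  set f : ℝ × ℝ → ℂ := fun v => Complex.exp (Complex.I * (v.1 * x 0 + v.2 * x 1)) *
    (lagF n 0 ((v.1 ^ 2 + v.2 ^ 2) / s ^ 2) : ℂ) with hf
  have hright : ∫ w, f (s • w) =
      2 * Real.pi * Complex.exp (-((s * x 0 : ℝ) ^ 2 + (s * x 1 : ℝ) ^ 2) / 4)
      * laguerreSum n (((s * x 0 : ℝ) ^ 2 + (s * x 1 : ℝ) ^ 2) / 2) := by
    rw [← integral_cexp_mul_lagF]
    refine integral_congr_ae (Filter.Eventually.of_forall fun w => ?_)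
    simp only [hf, Prod.smul_fst, Prod.smul_snd, smul_eq_mul]
    congr 2
    · push_cast
      ring_nf
    · congr 2
      field_simp
  rw [Measure.integral_comp_smul] at hright
  have hfin : Module.finrank ℝ (ℝ × ℝ) = 2 := by simp
  rw [hfin, abs_of_pos (by positivity), Complex.real_smul] at hright
  simp only [hleft]
  rw [integral_const_mul, Measure.integral_comp_mul_left, abs_of_pos (by positivity),
    Complex.real_smul, hG, integral_cexp_mul_hermiteF]
  simp only [E]
  push_cast at hright ⊢
  field_simp at hright ⊢
  rw [hright]
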